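/- Let Ψ be a transitive automorphism of ℙⁿ over F_q. Then for every point P ∈ ℙⁿ and every d ∈ {1,…,n−1}, there is no d-dimensional projective subspace W of ℙⁿ such that Ψ^i(P) ∈ W for all i ∈ {0,…,d+1}. -/

import Mathlib

open Polynomial

def IsTransitiveMap {X : Type*} (f : X → X) : Prop :=
  ∀ x y : X, ∃ i : ℕ, f^[i] x = y

noncomputable def projMap {F : Type*} [Field F] {n : ℕ}
    (M : (Fin (n + 1) → F) ≃ₗ[F] (Fin (n + 1) → F)) :
    Projectivization F (Fin (n + 1) → F) → Projectivization F (Fin (n + 1) → F) :=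
  Projectivization.map M.toLinearMap M.injective

/-- `P` lies in the affine chart `U = {Xₙ ≠ 0}`. -/
noncomputable def inU {F : Type*} [Field F] {n : ℕ}
    (P : Projectivization F (Fin (n + 1) → F)) : Prop :=
  P.rep (Fin.last n) ≠ 0

noncomputable def toProj {F : Type*} [Field F] {n : ℕ} (x : Fin n → F) :
    Projectivization F (Fin (n + 1) → F) :=
  Projectivization.mk F (Fin.snoc x 1) (by
    intro h
    simpa using congrFun h (Fin.last n))

noncomputable def toAff {F : Type*} [Field F] {n : ℕ}
    (P : Projectivization F (Fin (n + 1) → F)) : Fin n → F :=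
  fun i => P.rep i.castSucc / P.rep (Fin.last n)

noncomputable def jumpIndex {F : Type*} [Field F] {n : ℕ}
    (Ψ : Projectivization F (Fin (n + 1) → F) → Projectivization F (Fin (n + 1) → F))
    (P : Projectivization F (Fin (n + 1) → F)) : ℕ :=
  sInf {k : ℕ | 1 ≤ k ∧ inU (Ψ^[k] P)}

noncomputable def fracJump {F : Type*} [Field F] {n : ℕ}
    (M : (Fin (n + 1) → F) ≃ₗ[F] (Fin (n + 1) → F)) (x : Fin n → F) : Fin n → F :=
  toAff ((projMap M)^[jumpIndex (projMap M) (toProj x)] (toProj x))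

def ProjectivelyPrimitive {F : Type*} [Field F] (χ : Polynomial F) : Prop :=
  Irreducible χ ∧
  ∀ (K : Type) [Field K] [Algebra F K], Module.finrank F K = χ.natDegree →
    ∀ α : Kˣ, Polynomial.aeval (α : K) χ = 0 →
      Subgroup.zpowers
        (QuotientGroup.mk (s := (Units.map (algebraMap F K).toMonoidHom).range) α) = ⊤

noncomputable def ep (p : ℕ) (z : ZMod p) : ℂ :=
  Complex.exp (2 * Real.pi * Complex.I * (z.val : ℂ) / p)

noncomputable def snake {A : Type*} {n : ℕ} (hn : 0 < n)
    (ψ : (Fin n → A) → (Fin n → A)) (x : Fin n → A) (m : ℕ) : A :=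
  ψ^[(m - 1) / n] x ⟨(m - 1) % n, Nat.mod_lt _ hn⟩

open scoped Classical in
noncomputable def discrepancy (s N : ℕ) (γ : ℕ → Fin s → ℝ) : ℝ :=
  ⨆ α : Fin s → ℝ, ⨆ β : Fin s → ℝ,
    ⨆ _ : ∀ i, 0 ≤ α i ∧ α i ≤ β i ∧ β i ≤ 1,
      |(((Finset.range N).filter fun m => ∀ i, α i ≤ γ m i ∧ γ m i < β i).card : ℝ) / N
        - ∏ i, (β i - α i)|

noncomputable def Dsnake {p n : ℕ} (hn : 0 < n)
    (ψ : (Fin n → ZMod p) → (Fin n → ZMod p)) (s N : ℕ) (x : Fin n → ZMod p) : ℝ :=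
  discrepancy s N fun m i => ((snake hn ψ x (m + 1 + i)).val : ℝ) / p

noncomputable def DsnakeN {p n : ℕ} (hn : 0 < n)
    (ψ : (Fin n → ZMod p) → (Fin n → ZMod p)) (s N : ℕ) (x : Fin n → ZMod p) : ℝ :=
  discrepancy (s * n) N fun m i => ((snake hn ψ x (m * n + 1 + i)).val : ℝ) / p

/-- If the first `finrank W + 1` iterates of `v` under `f` lie in `W`, then `v` lies in an
`f`-invariant subspace contained in `W`. -/
theorem exists_invariant_le_of_pow_apply_mem {K V : Type*} [Field K] [AddCommGroup V] [Module K V]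
    [FiniteDimensional K V] (f : Module.End K V) (v : V) (W : Submodule K V)
    (h : ∀ i ≤ Module.finrank K W, (f ^ i) v ∈ W) :
    ∃ U ≤ W, v ∈ U ∧ ∀ x ∈ U, f x ∈ U := by
  set S : ℕ → Submodule K V := fun k => Submodule.span K ((fun i => (f ^ i) v) '' Set.Iio k) with hS
  have mem_S {i k : ℕ} (hik : i < k) : (f ^ i) v ∈ S k :=
    Submodule.subset_span ⟨i, hik, rfl⟩
  have mono_S (k : ℕ) : S k ≤ S (k + 1) :=
    Submodule.span_mono (Set.image_mono (Set.Iio_subset_Iio k.le_succ))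
  have S_le {k : ℕ} (hk : k ≤ Module.finrank K W + 1) : S k ≤ W := by
    rw [hS, Submodule.span_le]
    rintro _ ⟨i, hi, rfl⟩
    exact h i (Nat.lt_succ_iff.mp (lt_of_lt_of_le hi hk))
  by_cases hstab : ∃ k ≤ Module.finrank K W, S k = S (k + 1)
  · obtain ⟨k, hk, hkS⟩ := hstab
    refine ⟨S k, S_le (by omega), ?_, fun x hx => ?_⟩
    · rw [hkS]
      exact mem_S k.succ_pos
    · have hmap : S k ≤ (S (k + 1)).comap f := by
        rw [hS, Submodule.span_le]
        rintro _ ⟨i, hi, rfl⟩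
        have := mem_S (Nat.succ_lt_succ hi)
        rwa [pow_succ'] at this
      rw [hkS]
      exact hmap hx
  · push Not at hstab
    have hdim : ∀ k ≤ Module.finrank K W + 1, k ≤ Module.finrank K (S k) := by
      intro k
      induction k with
      | zero => simp
      | succ k ih =>
        intro hk
        have := Submodule.finrank_lt_finrank_of_lt
          (lt_of_le_of_ne (mono_S k) (hstab k (by omega)))
        have := ih (by omega)
        omega
    have := hdim _ le_rfl
    have := Submodule.finrank_mono (S_le le_rfl)
    omega

theorem projMap_iterate_mk {F : Type*} [Field F] {n : ℕ}
    (M : (Fin (n + 1) → F) ≃ₗ[F] (Fin (n + 1) → F)) (v : Fin (n + 1) → F) (hv : v ≠ 0) (i : ℕ) :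
    ∃ h : (M.toLinearMap ^ i) v ≠ 0,
      (projMap M)^[i] (Projectivization.mk F v hv) =
        Projectivization.mk F ((M.toLinearMap ^ i) v) h := by
  induction i with
  | zero => exact ⟨hv, rfl⟩
  | succ i ih =>
    obtain ⟨h, hi⟩ := ih
    have hsucc : (M.toLinearMap ^ (i + 1)) v = M ((M.toLinearMap ^ i) v) := by
      rw [pow_succ']; rfl
    refine ⟨by simpa [hsucc] using h, ?_⟩
    rw [Function.iterate_succ_apply', hi]
    simp only [hsucc]
    rfl

theorem rep_mk_mem_iff {K V : Type*} [Field K] [AddCommGroup V] [Module K V]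
    (W : Submodule K V) (v : V) (hv : v ≠ 0) :
    (Projectivization.mk K v hv).rep ∈ W ↔ v ∈ W := by
  obtain ⟨a, ha⟩ := Projectivization.exists_smul_eq_mk_rep K v hv
  rw [← ha]
  exact W.smul_mem_iff_of_isUnit a.isUnit

/-- A nonzero invariant subspace of a linear map inducing a transitive map on projective space is
the whole space. -/
theorem eq_top_of_isTransitiveMap {F : Type*} [Field F] {n : ℕ}
    (M : (Fin (n + 1) → F) ≃ₗ[F] (Fin (n + 1) → F)) (hM : IsTransitiveMap (projMap M))
    (U : Submodule F (Fin (n + 1) → F)) (v : Fin (n + 1) → F) (hv : v ≠ 0) (hvU : v ∈ U)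
    (hU : ∀ x ∈ U, M x ∈ U) : U = ⊤ := by
  have hpow (i : ℕ) : (M.toLinearMap ^ i) v ∈ U := by
    induction i with
    | zero => exact hvU
    | succ i ih =>
      rw [pow_succ']
      exact hU _ ih
  refine (Submodule.eq_top_iff').mpr fun x => ?_
  by_cases hx : x = 0
  · exact hx ▸ U.zero_mem
  obtain ⟨i, hi⟩ := hM (Projectivization.mk F v hv) (Projectivization.mk F x hx)
  obtain ⟨h, hi'⟩ := projMap_iterate_mk M v hv i
  rw [← rep_mk_mem_iff U x hx, ← hi, hi', rep_mk_mem_iff]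
  exact hpow i

/-- Subspace uniformity: if `Ψ` is a transitive automorphism of `ℙⁿ`, then for every `P ∈ ℙⁿ`
and every `d ∈ {1, …, n-1}` there is no `d`-dimensional projective subspace `W` (i.e. the
projectification of a `(d+1)`-dimensional linear subspace of `F_q^{n+1}`) containing
`Ψ^i(P)` for all `i ∈ {0, …, d+1}`. -/
theorem statement7 {F : Type*} [Field F] [Fintype F] (n : ℕ) (hn : 1 ≤ n)
    (M : (Fin (n + 1) → F) ≃ₗ[F] (Fin (n + 1) → F))
    (hM : IsTransitiveMap (projMap M))
    (P : Projectivization F (Fin (n + 1) → F)) (d : ℕ) (hd1 : 1 ≤ d) (hd2 : d ≤ n - 1) :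
    ¬ ∃ W : Submodule F (Fin (n + 1) → F), Module.finrank F W = d + 1 ∧
        ∀ i ≤ d + 1, ((projMap M)^[i] P).rep ∈ W := by
  rintro ⟨W, hW, hmem⟩
  obtain ⟨U, hUW, hvU, hU⟩ :=
    exists_invariant_le_of_pow_apply_mem M.toLinearMap P.rep W fun i hi => by
      obtain ⟨h, hi'⟩ := projMap_iterate_mk M P.rep P.rep_nonzero i
      have := hmem i (hW ▸ hi)
      rwa [← P.mk_rep, hi', rep_mk_mem_iff] at this
  have htop := eq_top_of_isTransitiveMap M hM U P.rep P.rep_nonzero hvU hU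
  have hle := Submodule.finrank_mono hUW
  rw [htop, finrank_top, Module.finrank_fin_fun, hW] at hle
  omega
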